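/- Let a, b, c, d be labels, and let φ = U(U(b,d), U(a,b)) and ψ = U(U(c,d), U(a,b)), where U(χ,τ) denotes the strict-until node formula ⟨(↓;?χ)*;↓⟩τ. Then φ is contained in ψ: for every tree T and node n, T,n⊨φ implies T,n⊨ψ. -/

import Mathlib

/- Trees over a label alphabet -/
structure RTree (A : Type) where
  Node : Type
  E : Node → Node → Prop
  root : Node
  label : Node → Set A

namespace RTree
variable {A : Type}

/-- Tree axioms not requiring finiteness of the node set: finite label sets,
    connectedness from the root, unique parents, acyclicity. -/
def IsPreTree (T : RTree A) : Prop :=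
  (∀ n, (T.label n).Finite) ∧
  (∀ n, Relation.ReflTransGen T.E T.root n) ∧
  (∀ n m m', T.E m n → T.E m' n → m = m') ∧
  (∀ n, ¬ Relation.TransGen T.E n n)

/-- A (finite, rooted, unranked) tree. -/
def IsTree (T : RTree A) : Prop := T.IsPreTree ∧ Finite T.Node

/-- Single-labeled (XML) trees: every node carries exactly one label. -/
def SingleLabeled (T : RTree A) : Prop := ∀ n, ∃ p, T.label n = {p}

end RTree

/-- CTP^{¬,∨} node formulas, generated by p, ¬p, ⊤, ∧, ∨, ⟨↓⟩ and the strict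
until U(·,·) (the translation target needs ∨; the bullet translation itself
only produces ∨-free formulas, i.e. CTP^¬ node formulas). -/
inductive CF (A : Type) : Type where
  | lab : A → CF A
  | nlab : A → CF A
  | top : CF A
  | and : CF A → CF A → CF A
  | or : CF A → CF A → CF A
  | ex : CF A → CF A
  | untl : CF A → CF A → CF A

variable {A : Type}

/-- Satisfaction: `untl σ θ` is the strict until U(σ,θ) = ⟨(↓;?σ)*;↓⟩θ : some
strict descendant satisfies θ and every node strictly in between satisfies σ. -/
def CF.sat (T : RTree A) : CF A → Set T.Node
  | .lab p => {n | p ∈ T.label n}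
  | .nlab p => {n | p ∉ T.label n}
  | .top => Set.univ
  | .and φ ψ => {n | n ∈ CF.sat T φ ∧ n ∈ CF.sat T ψ}
  | .or φ ψ => {n | n ∈ CF.sat T φ ∨ n ∈ CF.sat T ψ}
  | .ex φ => {n | ∃ m, T.E n m ∧ m ∈ CF.sat T φ}
  | .untl σ θ => {n | ∃ m, Relation.TransGen T.E n m ∧ m ∈ CF.sat T θ ∧
      ∀ k, Relation.TransGen T.E n k → Relation.TransGen T.E k m →
        k ∈ CF.sat T σ}
/-- Labels (positive or negated) occurring in a formula. -/
def CF.labs : CF A → Set A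
  | .lab p => {p}
  | .nlab p => {p}
  | .top => ∅
  | .and φ ψ => CF.labs φ ∪ CF.labs ψ
  | .or φ ψ => CF.labs φ ∪ CF.labs ψ
  | .ex φ => CF.labs φ
  | .untl σ θ => CF.labs σ ∪ CF.labs θ


/-- for labels a, b, c, d, the CTP node formula
φ = U(U(b,d), U(a,b)) is contained in ψ = U(U(c,d), U(a,b)): every node of
every tree satisfying φ also satisfies ψ.  Here `CF.untl χ τ` is the strict
until U(χ,τ) = ⟨(↓;?χ)*;↓⟩τ. -/
theorem ctp_until_containment_example (a b c d : A)
    (T : RTree A) (hT : T.IsTree) (n : T.Node)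
    (h : n ∈ CF.sat T (.untl (.untl (.lab b) (.lab d))
      (.untl (.lab a) (.lab b)))) :
    n ∈ CF.sat T (.untl (.untl (.lab c) (.lab d))
      (.untl (.lab a) (.lab b))) := by
  obtain ⟨⟨-, -, huniq, hacyc⟩, hfin⟩ := hT
  -- a child is reached with no node strictly in between
  have hchild : ∀ k x y, T.E k x → Relation.TransGen T.E k y →
      Relation.TransGen T.E y x → False := by
    intro k x y hkx hky hyx
    obtain ⟨z, hyz, hzx⟩ := Relation.TransGen.tail'_iff.1 hyx
    have hz : z = k := huniq x z k hzx hkx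
    subst hz
    exact hacyc _ (hky.trans_left hyz)
  have hwf : WellFounded (Relation.TransGen T.E) := by
    have : Std.Irrefl (Relation.TransGen T.E) := ⟨hacyc⟩
    exact Finite.wellFounded_of_trans_of_irrefl _
  let S : Set T.Node := {m | Relation.TransGen T.E n m ∧
    m ∈ CF.sat T (.untl (.lab a) (.lab b)) ∧
      ∀ k, Relation.TransGen T.E n k → Relation.TransGen T.E k m →
        k ∈ CF.sat T (.untl (.lab b) (.lab d))}
  obtain ⟨m, ⟨hnm, hm, hbet⟩, hmin⟩ := hwf.has_min S h
  refine ⟨m, hnm, hm, fun k hnk hkm => ?_⟩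
  obtain ⟨w, hkw, hw, hkb⟩ := hbet k hnk hkm
  obtain ⟨x, hkx, hxw⟩ := Relation.TransGen.head'_iff.1 hkw
  rcases Relation.reflTransGen_iff_eq_or_transGen.1 hxw with rfl | hxw'
  · exact ⟨_, .single hkx, hw, fun y h1 h2 => (hchild k _ y hkx h1 h2).elim⟩
  · exfalso
    refine hmin k ⟨hnk, ⟨x, .single hkx, hkb x (.single hkx) hxw', ?_⟩, ?_⟩ hkm
    · exact fun y h1 h2 => (hchild k x y hkx h1 h2).elim
    · exact fun y h1 h2 => hbet y h1 (h2.trans hkm)
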